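/- Suppose k is algebraically closed of characteristic 0. Let A = k_p[x_1,x_2,x_3] be a skew polynomial ring in three variables in which every parameter p_ij is a root of unity. Then A is cancellative in the class of connected graded k-algebras: for every connected ℕ-graded k-algebra B, if there is a k-algebra isomorphism A[t] ≅ B[t], then A ≅ B as k-algebras. -/

import Mathlib

noncomputable section

/-- The defining relations of the skew polynomial ring `k_p[x_1,...,x_n]`:
`x_j x_i = p_{ij}·x_i x_j` for `i < j`. -/
inductive SkewPolyRel (k : Type*) [Field k] (n : ℕ) (p : Fin n → Fin n → k) :
    FreeAlgebra k (Fin n) → FreeAlgebra k (Fin n) → Prop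
  | rel (i j : Fin n) (hij : i < j) :
      SkewPolyRel k n p (FreeAlgebra.ι k j * FreeAlgebra.ι k i)
        (p i j • (FreeAlgebra.ι k i * FreeAlgebra.ι k j))

/-- The skew polynomial ring `k_p[x_1,...,x_n]`. -/
abbrev SkewPoly (k : Type*) [Field k] (n : ℕ) (p : Fin n → Fin n → k) :=
  RingQuot (SkewPolyRel k n p)

namespace Cancel

section PBW
variable {k : Type*} [Field k] (p : Fin 3 → Fin 3 → k)

/-- generator -/
def gx (i : Fin 3) : SkewPoly k 3 p :=
  RingQuot.mkAlgHom k (SkewPolyRel k 3 p) (FreeAlgebra.ι k i)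

theorem gx_rel {i j : Fin 3} (h : i < j) :
    gx p j * gx p i = p i j • (gx p i * gx p j) := by
  have := RingQuot.mkAlgHom_rel k (SkewPolyRel.rel (k := k) (p := p) i j h)
  simpa [gx] using this

theorem adjoin_gx : Algebra.adjoin k (Set.range (gx p)) = ⊤ := by
  have h1 := FreeAlgebra.adjoin_range_ι k (Fin 3)
  have h2 := congrArg (Subalgebra.map (RingQuot.mkAlgHom k (SkewPolyRel k 3 p))) h1
  rw [AlgHom.map_adjoin, Algebra.map_top, ← Set.range_comp,
    (AlgHom.range_eq_top _).2 (RingQuot.mkAlgHom_surjective k _)] at h2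
  exact h2

/-- universal property -/
def lift {R : Type*} [Semiring R] [Algebra k R] (r : Fin 3 → R)
    (h : ∀ i j, i < j → r j * r i = p i j • (r i * r j)) : SkewPoly k 3 p →ₐ[k] R :=
  RingQuot.liftAlgHom k ⟨FreeAlgebra.lift k r, by
    rintro _ _ ⟨i, j, hij⟩
    simpa using h i j hij⟩

theorem lift_gx {R : Type*} [Semiring R] [Algebra k R] (r : Fin 3 → R)
    (h : ∀ i j, i < j → r j * r i = p i j • (r i * r j)) (i : Fin 3) :
    lift p r h (gx p i) = r i := by
  simp [lift, gx]

/-- the scalar -/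
def sc (i : Fin 3) (a : Fin 3 → ℕ) : k := ∏ l, if l < i then p l i ^ a l else 1

theorem sc_ne (hp : ∀ i j, p i j ≠ 0) (i : Fin 3) (a : Fin 3 → ℕ) : sc p i a ≠ 0 := by
  unfold sc
  refine Finset.prod_ne_zero_iff.2 fun l _ => ?_
  split_ifs
  · exact pow_ne_zero _ (hp _ _)
  · exact one_ne_zero

/-- operators -/
def op (i : Fin 3) : Module.End k ((Fin 3 → ℕ) →₀ k) :=
  Finsupp.lsum k fun a => (sc p i a) • Finsupp.lsingle (a + Pi.single i 1)

theorem op_single (i : Fin 3) (a : Fin 3 → ℕ) (c : k) :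
    op p i (Finsupp.single a c) = Finsupp.single (a + Pi.single i 1) (sc p i a * c) := by
  simp [op]

theorem op_rel (i j : Fin 3) (h : i < j) : op p j * op p i = p i j • (op p i * op p j) := by
  ext a : 2
  simp only [LinearMap.comp_apply, Finsupp.lsingle_apply, Module.End.mul_apply, op_single,
    LinearMap.smul_apply, Finsupp.smul_single]
  rw [add_right_comm]
  congr 1
  fin_cases i <;> fin_cases j <;> simp at h <;>
    simp [sc, Fin.prod_univ_three, pow_succ] <;> ring

/-- representation -/
def rep : SkewPoly k 3 p →ₐ[k] Module.End k ((Fin 3 → ℕ) →₀ k) := lift p (op p) (op_rel p)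

theorem rep_gx (i : Fin 3) : rep p (gx p i) = op p i := lift_gx _ _ _ _

/-- ordered monomials -/
def mon (a : Fin 3 → ℕ) : SkewPoly k 3 p := gx p 0 ^ a 0 * gx p 1 ^ a 1 * gx p 2 ^ a 2

theorem gx_pow {i j : Fin 3} (h : i < j) (n : ℕ) :
    gx p j * gx p i ^ n = p i j ^ n • (gx p i ^ n * gx p j) := by
  induction n with
  | zero => simp
  | succ n ih =>
    rw [pow_succ, ← mul_assoc, ih, smul_mul_assoc, mul_assoc, gx_rel p h, mul_smul_comm, smul_smul,
      mul_assoc, pow_succ]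

theorem gx_mon (i : Fin 3) (a : Fin 3 → ℕ) :
    gx p i * mon p a = sc p i a • mon p (a + Pi.single i 1) := by
  fin_cases i
  · simp [mon, sc, pow_succ', mul_assoc]
  · simp only [mon, sc, Fin.prod_univ_three, Fin.mk_one, ← mul_assoc]
    rw [gx_pow p (by decide : (0 : Fin 3) < 1)]
    simp [pow_succ', mul_assoc]
  · simp only [mon, sc, Fin.prod_univ_three, Fin.reduceFinMk, ← mul_assoc]
    rw [gx_pow p (by decide : (0 : Fin 3) < 2)]
    simp only [smul_mul_assoc]
    rw [mul_assoc (gx p 0 ^ a 0), gx_pow p (by decide : (1 : Fin 3) < 2)]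
    simp [pow_succ', mul_assoc, smul_smul]

/-- coordinates to algebra -/
def LL : ((Fin 3 → ℕ) →₀ k) →ₗ[k] SkewPoly k 3 p := Finsupp.linearCombination k (mon p)

theorem LL_rep (a : SkewPoly k 3 p) : ∀ w, LL p (rep p a w) = a * LL p w := by
  have ha : a ∈ Algebra.adjoin k (Set.range (gx p)) := by rw [adjoin_gx]; trivial
  induction ha using Algebra.adjoin_induction with
  | mem x hx =>
    obtain ⟨i, rfl⟩ := hx
    intro w
    induction w using Finsupp.induction_linear with
    | zero => simp
    | add f g hf hg => simp only [map_add, hf, hg, mul_add]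
    | single b c =>
      rw [rep_gx, op_single]
      simp only [LL, Finsupp.linearCombination_single, mul_smul_comm, gx_mon, smul_smul]
      rw [mul_comm]
  | algebraMap r => intro w; simp [Algebra.smul_def, AlgHom.commutes]
  | add x y _ _ hx hy => intro w; simp [hx, hy, add_mul]
  | mul x y _ _ hx hy => intro w; simp [hx, hy, mul_assoc]

theorem LL_one (a : SkewPoly k 3 p) : LL p (rep p a (Finsupp.single 0 1)) = a := by
  rw [LL_rep]
  simp [LL, mon]

theorem rep_pow (hp : ∀ i j, p i j ≠ 0) (i : Fin 3) (n : ℕ) (b : Fin 3 → ℕ) (c : k) (hc : c ≠ 0) :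
    ∃ s : k, s ≠ 0 ∧ rep p (gx p i ^ n) (Finsupp.single b c)
      = Finsupp.single (b + Pi.single i n) s := by
  induction n with
  | zero => exact ⟨c, hc, by simp⟩
  | succ n ih =>
    obtain ⟨s, hs, h⟩ := ih
    refine ⟨sc p i (b + Pi.single i n) * s, mul_ne_zero (sc_ne p hp _ _) hs, ?_⟩
    rw [pow_succ', map_mul, Module.End.mul_apply, h, rep_gx, op_single, add_assoc,
      ← Pi.single_add]

theorem rep_mon (hp : ∀ i j, p i j ≠ 0) (a b : Fin 3 → ℕ) :
    ∃ s : k, s ≠ 0 ∧ rep p (mon p a) (Finsupp.single b 1) = Finsupp.single (a + b) s := by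
  obtain ⟨s, hs, h⟩ := rep_pow p hp 2 (a 2) b 1 one_ne_zero
  obtain ⟨s', hs', h'⟩ := rep_pow p hp 1 (a 1) (b + Pi.single 2 (a 2)) s hs
  obtain ⟨s'', hs'', h''⟩ := rep_pow p hp 0 (a 0)
    (b + Pi.single 2 (a 2) + Pi.single 1 (a 1)) s' hs'
  refine ⟨s'', hs'', ?_⟩
  rw [mon, map_mul, map_mul, Module.End.mul_apply, Module.End.mul_apply, h, h', h'']
  congr 1
  ext i
  fin_cases i <;> simp <;> exact add_comm _ _

theorem rep_inj (hp : ∀ i j, p i j ≠ 0) (f w : (Fin 3 → ℕ) →₀ k) (hf : f ≠ 0) (hw : w ≠ 0) :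
    rep p (LL p f) w ≠ 0 := by
  choose s hs h using rep_mon p hp
  have key : rep p (LL p f) w
      = f.sum fun a c => w.sum fun b d => Finsupp.single (a + b) (c * d * s a b) := by
    rw [LL, Finsupp.linearCombination_apply, Finsupp.sum, map_sum, LinearMap.sum_apply]
    refine Finset.sum_congr rfl fun a _ => ?_
    conv_lhs => rw [← Finsupp.sum_single w]
    rw [Finsupp.sum, map_sum]
    refine Finset.sum_congr rfl fun b _ => ?_
    rw [← mul_one (w b), ← smul_eq_mul, ← Finsupp.smul_single, map_smul, map_smul,
      LinearMap.smul_apply, h]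
    simp only [Finsupp.smul_single, smul_eq_mul, mul_one]
    congr 1; ring
  obtain ⟨a0, ha0, b0, hb0, hu⟩ := UniqueSums.uniqueAdd_of_nonempty
    (Finsupp.support_nonempty_iff.2 hf) (Finsupp.support_nonempty_iff.2 hw)
  intro h0
  have h1 := congrArg (fun z => z (a0 + b0)) (key.symm.trans h0)
  simp only [Finsupp.sum, Finsupp.coe_finsetSum, Finset.sum_apply, Finsupp.coe_zero,
    Pi.zero_apply, Finsupp.single_apply] at h1
  rw [Finset.sum_eq_single a0, Finset.sum_eq_single b0] at h1
  · simp only [if_true] at h1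
    exact mul_ne_zero (mul_ne_zero (Finsupp.mem_support_iff.1 ha0)
      (Finsupp.mem_support_iff.1 hb0)) (hs _ _) h1
  · intro b hb hne
    rw [if_neg]
    intro he
    exact hne (hu ha0 hb he).2
  · intro hh; exact absurd hb0 hh
  · intro a ha hne
    refine Finset.sum_eq_zero fun b hb => ?_
    rw [if_neg]
    intro he
    exact hne (hu ha hb he).1
  · intro hh; exact absurd ha0 hh

theorem noZeroDiv (hp : ∀ i j, p i j ≠ 0) : NoZeroDivisors (SkewPoly k 3 p) := by
  refine ⟨fun {a b} hab => ?_⟩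
  by_contra hcon
  push Not at hcon
  set f := rep p a (Finsupp.single 0 1) with hf
  set w := rep p b (Finsupp.single 0 1) with hw
  have hf0 : f ≠ 0 := fun h => hcon.1 (by rw [← LL_one p a, ← hf, h, map_zero])
  have hw0 : w ≠ 0 := fun h => hcon.2 (by rw [← LL_one p b, ← hw, h, map_zero])
  apply rep_inj p hp f w hf0 hw0
  rw [hf, LL_one, hw, ← Module.End.mul_apply, ← map_mul, hab, map_zero, LinearMap.zero_apply]

theorem gx_ne (hp : ∀ i j, p i j ≠ 0) (i : Fin 3) : gx p i ≠ 0 := by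
  intro h
  have h1 := rep_gx p i
  rw [h, map_zero] at h1
  have h2 := congrArg (fun z => z (Finsupp.single 0 1)) h1
  simp only [op_single, LinearMap.zero_apply] at h2
  have := (Finsupp.single_eq_zero.1 h2.symm)
  exact mul_ne_zero (sc_ne p hp i 0) one_ne_zero this

theorem nontriv (hp : ∀ i j, p i j ≠ 0) : Nontrivial (SkewPoly k 3 p) := ⟨_, _, gx_ne p hp 0⟩

end PBW

section Gen
open Polynomial DirectSum

/-- a surjective augmentation-preserving endomorphism is injective -/
theorem ker_eq_mul_top {k R : Type*} [Field k] [Ring R] [Algebra k R] {ι : Type*} (z : ι → R)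
    (hz : Algebra.adjoin k (Set.range z) = ⊤) (ε : R →ₐ[k] k) (h0 : ∀ i, ε (z i) = 0) :
    LinearMap.ker ε.toLinearMap = Submodule.span k (Set.range z) * ⊤ := by
  set Z := Submodule.span k (Set.range z) with hZ
  have hle : Z * ⊤ ≤ LinearMap.ker ε.toLinearMap := by
    rw [Submodule.mul_le]
    intro a ha b _
    have : Z ≤ LinearMap.ker ε.toLinearMap := by
      rw [hZ, Submodule.span_le]
      rintro _ ⟨i, rfl⟩
      simpa using h0 i
    have := this ha
    simp only [LinearMap.mem_ker, AlgHom.toLinearMap_apply] at this ⊢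
    rw [map_mul, this, zero_mul]
  have key : ∀ x : R, ∃ c : k, x - algebraMap k R c ∈ Z * (⊤ : Submodule k R) := by
    intro x
    have hx : x ∈ Algebra.adjoin k (Set.range z) := by rw [hz]; trivial
    induction hx using Algebra.adjoin_induction with
    | mem x hx =>
      refine ⟨0, ?_⟩
      rw [map_zero, sub_zero, ← mul_one x]
      exact Submodule.mul_mem_mul (Submodule.subset_span hx) trivial
    | algebraMap r => exact ⟨r, by simp⟩
    | add x y _ _ hx hy =>
      obtain ⟨c, hc⟩ := hx
      obtain ⟨d, hd⟩ := hy
      refine ⟨c + d, ?_⟩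
      have := add_mem hc hd
      rw [map_add]; convert this using 1; abel
    | mul x y _ _ hx hy =>
      obtain ⟨c, hc⟩ := hx
      obtain ⟨d, hd⟩ := hy
      refine ⟨c * d, ?_⟩
      have h1 : (x - algebraMap k R c) * y ∈ Z * (⊤ : Submodule k R) := by
        have := Submodule.mul_mem_mul hc (Submodule.mem_top (R := k) (x := y))
        rw [mul_assoc] at this
        exact mul_le_mul' (le_refl Z) (le_top : (⊤ * ⊤ : Submodule k R) ≤ ⊤) this
      have := add_mem h1 (Submodule.smul_mem _ c hd)
      convert this using 1
      rw [Algebra.smul_def, map_mul]; noncomm_ring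
  refine le_antisymm ?_ hle
  intro x hx
  obtain ⟨c, hc⟩ := key x
  have h1 := hle hc
  simp only [LinearMap.mem_ker, AlgHom.toLinearMap_apply, map_sub, AlgHom.commutes] at h1 hx
  rw [hx, zero_sub, neg_eq_zero] at h1
  have : c = 0 := h1
  simpa [this] using hc

theorem quot_fg {k R : Type*} [Field k] [Ring R] [Algebra k R] (ε : R →ₐ[k] k)
    (Z : Submodule k R) (hZ : Z.FG) (h : LinearMap.ker ε.toLinearMap = Z * ⊤) (n : ℕ) :
    ∃ P : Submodule k R, P.FG ∧ P ⊔ (LinearMap.ker ε.toLinearMap) ^ (n + 1) = ⊤ := by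
  set N := LinearMap.ker ε.toLinearMap with hN
  have h1 : (1 : Submodule k R) ⊔ N = ⊤ := by
    rw [eq_top_iff]
    intro x _
    have : x = algebraMap k R (ε x) + (x - algebraMap k R (ε x)) := by abel
    rw [this]
    refine Submodule.add_mem_sup (Submodule.algebraMap_mem _) ?_
    simp [hN]
  have hZN : Z ≤ N := by
    rw [h]
    intro z hz
    rw [← mul_one z]
    exact Submodule.mul_mem_mul hz trivial
  have h1fg : (1 : Submodule k R).FG := by
    rw [Submodule.one_eq_span]; exact Submodule.fg_span_singleton _
  induction n with
  | zero => exact ⟨1, h1fg, by simpa using h1⟩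
  | succ n ih =>
    obtain ⟨P, hP, hPt⟩ := ih
    refine ⟨1 ⊔ Z * P, h1fg.sup (hZ.mul hP), ?_⟩
    rw [eq_top_iff, ← h1, sup_assoc]
    refine sup_le_sup_left ?_ _
    calc N = Z * (P ⊔ N ^ (n + 1)) := by rw [hPt, h]
      _ = Z * P ⊔ Z * N ^ (n + 1) := Submodule.mul_sup _ _ _
      _ ≤ _ := by
        refine sup_le_sup_left ?_ _
        rw [pow_succ' N (n + 1)]
        exact mul_le_mul' hZN le_rfl

theorem hopf {k R : Type*} [Field k] [Ring R] [Algebra k R] (ε : R →ₐ[k] k)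
    (Z : Submodule k R) (hZ : Z.FG) (h : LinearMap.ker ε.toLinearMap = Z * ⊤)
    (hinf : ∀ x : R, (∀ n : ℕ, x ∈ (LinearMap.ker ε.toLinearMap) ^ (n + 1)) → x = 0)
    (π : R →ₐ[k] R) (hπ : Function.Surjective π) (he : ∀ x, ε (π x) = ε x) :
    Function.Injective π := by
  rw [injective_iff_map_eq_zero]
  intro x hx
  apply hinf
  intro n
  set N := LinearMap.ker ε.toLinearMap with hN
  obtain ⟨P, hP, hPt⟩ := quot_fg ε Z hZ h n
  have hfin : Module.Finite k (R ⧸ N ^ (n + 1)) := by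
    have : Module.Finite k P := Module.Finite.iff_fg.2 hP
    refine Module.Finite.of_surjective ((N ^ (n + 1)).mkQ.comp P.subtype) ?_
    rw [← LinearMap.range_eq_top, LinearMap.range_comp, Submodule.range_subtype]
    rw [← Submodule.range_mkQ (N ^ (n + 1)), LinearMap.range_eq_map, ← hPt, Submodule.map_sup, ← hN]
    simp
  have hmap : N ^ (n + 1) ≤ (N ^ (n + 1)).comap π.toLinearMap := by
    rw [← Submodule.map_le_iff_le_comap, Submodule.map_pow]
    gcongr
    rintro _ ⟨y, hy, rfl⟩
    have hy' : ε y = 0 := hy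
    simp [hN, he, hy']
  set q := Submodule.mapQ _ _ π.toLinearMap hmap with hq
  have hqs : Function.Surjective q := by
    intro y
    obtain ⟨y, rfl⟩ := Submodule.mkQ_surjective _ y
    obtain ⟨w, rfl⟩ := hπ y
    exact ⟨(N ^ (n + 1)).mkQ w, by simp [hq]⟩
  have hqi : Function.Injective q := LinearMap.injective_iff_surjective.2 hqs
  rw [← Submodule.Quotient.mk_eq_zero]
  apply hqi
  rw [hq, Submodule.mapQ_apply, map_zero]
  simp [hx]

theorem exchange {k V : Type*} [Field k] [AddCommGroup V] [Module k V] {ι : Type*} [Fintype ι]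
    [DecidableEq ι]
    (W m : Submodule k V) (u : ι → V) (uc : ι → ℕ → V) (s : ι → Finset ℕ)
    (hu : ∀ i, u i = ∑ d ∈ s i, uc i d) (huc : ∀ i d, uc i d ∈ m)
    (hm : W ⊔ Submodule.span k (Set.range u) = m) :
    ∃ d : ι → ℕ, W ⊔ Submodule.span k (Set.range fun i => uc i (d i)) = m := by
  have key : ∀ t : Finset ι, ∃ f : ι → V, W ⊔ Submodule.span k (Set.range f) = m ∧
      (∀ i ∈ t, ∃ d, f i = uc i d) ∧ ∀ i ∉ t, f i = u i := by
    intro t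
    induction t using Finset.induction_on with
    | empty => exact ⟨u, hm, by simp, by simp⟩
    | insert j t hj ih =>
      obtain ⟨f, hf, h1, h2⟩ := ih
      set W' := W ⊔ Submodule.span k (f '' {j}ᶜ) with hW'
      have hup : ∀ x, W ⊔ Submodule.span k (Set.range (Function.update f j x))
          = Submodule.span k {x} ⊔ W' := by
        intro x
        have : Set.range (Function.update f j x) = {x} ∪ f '' {j}ᶜ := by
          ext y
          constructor
          · rintro ⟨i, rfl⟩
            by_cases hi : i = j
            · subst hi; simp
            · right; exact ⟨i, hi, by simp [hi]⟩
          · rintro (h | ⟨i, hi, rfl⟩)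
            · exact ⟨j, by simp at h; simp [h]⟩
            · exact ⟨i, by have : i ≠ j := hi
                           simp [this]⟩
        rw [this, Submodule.span_union, hW', sup_left_comm]
      have hfj : Submodule.span k {f j} ⊔ W' = m := by
        rw [← hup, Function.update_eq_self, hf]
      have hex : ∃ d, Submodule.span k {uc j d} ⊔ W' = m := by
        by_cases hmem : f j ∈ W'
        · refine ⟨0, ?_⟩
          have hWm : W' = m := by
            rw [← hfj, eq_comm, sup_eq_right, Submodule.span_singleton_le_iff_mem]
            exact hmem
          rw [hWm, sup_eq_right, Submodule.span_singleton_le_iff_mem]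
          exact huc _ _
        · have hcov := Submodule.covBy_span_singleton_sup hmem
          rw [hfj] at hcov
          have : ∃ d, uc j d ∉ W' := by
            by_contra hcon
            push Not at hcon
            apply hmem
            rw [h2 j hj, hu j]
            exact Submodule.sum_mem _ fun d _ => hcon d
          obtain ⟨d, hd⟩ := this
          refine ⟨d, ?_⟩
          have hlt := (Submodule.covBy_span_singleton_sup hd).lt
          refine (hcov.eq_or_eq hlt.le ?_).resolve_left hlt.ne'
          exact sup_le (by rw [Submodule.span_singleton_le_iff_mem]; exact huc _ _) hcov.le
      obtain ⟨d, hd⟩ := hex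
      refine ⟨Function.update f j (uc j d), by rw [hup, hd], ?_, ?_⟩
      · intro i hi
        by_cases hij : i = j
        · subst hij; exact ⟨d, by simp⟩
        · simp only [Finset.mem_insert, hij, false_or] at hi
          simpa [hij] using h1 i hi
      · intro i hi
        simp only [Finset.mem_insert, not_or] at hi
        simpa [hi.1] using h2 i hi.2
  obtain ⟨f, hf, h1, _⟩ := key Finset.univ
  choose d hd using fun i => h1 i (Finset.mem_univ i)
  exact ⟨d, by rw [← hf]; congr; ext i; rw [hd]⟩

theorem trail {k R : Type*} [Field k] [Ring R] [Algebra k R] (f g : R[X]) (P : k)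
    (h : g * f = P • (f * g)) :
    g.trailingCoeff * f.coeff 0 = P • (f.coeff 0 * g.trailingCoeff) := by
  have hlow : ∀ i < g.natTrailingDegree, g.coeff i = 0 := fun i hi =>
    coeff_eq_zero_of_lt_natTrailingDegree hi
  have h1 := congrArg (fun z => z.coeff g.natTrailingDegree) h
  simp only [coeff_smul, coeff_mul] at h1
  rw [Finset.sum_eq_single (g.natTrailingDegree, 0), Finset.sum_eq_single (0, g.natTrailingDegree)]
    at h1
  · exact h1
  · rintro ⟨a, b⟩ hab hne
    rw [Finset.HasAntidiagonal.mem_antidiagonal] at hab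
    rw [hlow b, mul_zero]
    by_contra hcon
    apply hne
    ext <;> simp at * <;> omega
  · intro hh; simp at hh
  · rintro ⟨a, b⟩ hab hne
    rw [Finset.HasAntidiagonal.mem_antidiagonal] at hab
    rw [hlow a, zero_mul]
    by_contra hcon
    apply hne
    ext <;> simp at * <;> omega
  · intro hh; simp at hh

end Gen

section Graded
open Polynomial DirectSum

variable {k B : Type*} [Field k] [Ring B] [Algebra k B] (ℬ : ℕ → Submodule k B) [GradedAlgebra ℬ]

/-- homogeneous component -/
def comp (n : ℕ) : B →ₗ[k] B where
  toFun b := (decompose ℬ b n : B)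
  map_add' := by intro a b; simp
  map_smul' := by intro a b; rw [decompose_smul]; rfl

theorem comp_mem (n : ℕ) (b : B) : comp ℬ n b ∈ ℬ n := (decompose ℬ b n).2

theorem comp_same {n : ℕ} {b : B} (h : b ∈ ℬ n) : comp ℬ n b = b := decompose_of_mem_same ℬ h

theorem comp_ne {n m : ℕ} {b : B} (h : b ∈ ℬ n) (hne : n ≠ m) : comp ℬ m b = 0 :=
  decompose_of_mem_ne ℬ h hne

theorem sum_comp (b : B) : ∃ s : Finset ℕ, b = ∑ d ∈ s, comp ℬ d b :=
  by classical exact ⟨_, (sum_support_decompose ℬ b).symm⟩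

theorem eq_zero_of_comp {b : B} (h : ∀ n, comp ℬ n b = 0) : b = 0 := by
  obtain ⟨s, hs⟩ := sum_comp ℬ b
  rw [hs]; exact Finset.sum_eq_zero fun d _ => h d

theorem exists_co : ∃ co : B →ₐ[k] B[X], ∀ b n, (co b).coeff n = comp ℬ n b := by
  let f : ∀ i, ℬ i →ₗ[k] B[X] := fun i => ((monomial i : B →ₗ[B] B[X]).restrictScalars k).comp
    (ℬ i).subtype
  let T : (⨁ i, ℬ i) →ₐ[k] B[X] := DirectSum.toAlgebra (R := k) (A := fun i => ℬ i) f
    (by simp only [f, LinearMap.comp_apply]; rfl)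
    (by
      intro i j a b
      simp only [f, LinearMap.comp_apply, LinearMap.restrictScalars_apply, Submodule.subtype_apply,
        monomial_mul_monomial]
      rfl)
  refine ⟨T.comp (decomposeAlgEquiv ℬ).toAlgHom, ?_⟩
  have hh : ∀ i, ∀ b ∈ ℬ i, T (decomposeAlgEquiv ℬ b) = monomial i b := by
    intro i b hb
    have : decomposeAlgEquiv ℬ b = DirectSum.of (fun i => ℬ i) i ⟨b, hb⟩ := decompose_of_mem ℬ hb
    rw [this]
    change DirectSum.toAddMonoid (fun i => (f i).toAddMonoidHom)
      (DirectSum.of (fun i => ℬ i) i ⟨b, hb⟩) = _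
    rw [DirectSum.toAddMonoid_of]
    rfl
  intro b n
  obtain ⟨s, hs⟩ := sum_comp ℬ b
  have : ∀ x : B, ∀ d, (T (decomposeAlgEquiv ℬ (comp ℬ d x))).coeff n
      = comp ℬ n (comp ℬ d x) := by
    intro x d
    rw [hh d _ (comp_mem ℬ d x), coeff_monomial]
    split_ifs with h
    · subst h; rw [comp_same ℬ (comp_mem ℬ d x)]
    · rw [comp_ne ℬ (comp_mem ℬ d x) h]
  rw [hs]
  simp only [map_sum, finsetSum_coeff]
  refine Finset.sum_congr rfl fun d _ => this b d

theorem exists_aug [Nontrivial B] (hconn : ∀ b ∈ ℬ 0, ∃ c : k, b = algebraMap k B c) :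
    ∃ ε : B →ₐ[k] k, ∀ b, comp ℬ 0 b = algebraMap k B (ε b) := by
  choose e he using fun b => hconn _ (comp_mem ℬ 0 b)
  have hinj : Function.Injective (algebraMap k B) := (algebraMap k B).injective
  obtain ⟨co, hco⟩ := exists_co ℬ
  have h1 : ∀ b, comp ℬ 0 b = constantCoeff (co b) := fun b => by simp [hco]
  refine ⟨⟨⟨⟨⟨e, ?_⟩, ?_⟩, ?_, ?_⟩, ?_⟩, he⟩
  · apply hinj; rw [← he, h1]; simp
  · intro a b; apply hinj; dsimp only; rw [map_mul, ← he, ← he, ← he, h1, h1, h1]; simp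
  · apply hinj; dsimp only; rw [← he, h1]; simp
  · intro a b; apply hinj; dsimp only; rw [map_add, ← he, ← he, ← he, h1, h1, h1]; simp
  · intro c
    apply hinj
    change algebraMap k B (e _) = algebraMap k B c
    rw [← he, h1, AlgHom.commutes, Polynomial.algebraMap_apply]
    simp

theorem skew_comp [NoZeroDivisors B] {u v : B} (hn : ∀ b, ∃ b', u * b = b' * u) (q : k)
    (h : u * v = q • (v * u)) (d e : ℕ) :
    comp ℬ e u * comp ℬ d v = q • (comp ℬ d v * comp ℬ e u) := by
  by_cases hu : u = 0
  · subst hu; simp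
  obtain ⟨co, hco⟩ := exists_co ℬ
  have hcoi : ∀ b, co b = 0 → b = 0 := fun b hb => eq_zero_of_comp ℬ fun n => by
    rw [← hco, hb, coeff_zero]
  have hcom : ∀ d b, co (comp ℬ d b) = monomial d (comp ℬ d b) := by
    intro d b
    ext n
    rw [hco, coeff_monomial]
    split_ifs with h
    · subst h; rw [comp_same ℬ (comp_mem ℬ d b)]
    · rw [comp_ne ℬ (comp_mem ℬ d b) h]
  choose b' hb' using fun d => hn (comp ℬ d v)
  have hmon : ∀ d, co (b' d) = monomial d (comp ℬ d (b' d)) := by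
    intro d
    by_cases hv : comp ℬ d v = 0
    · have : b' d = 0 := by
        have h1 := hb' d
        rw [hv, mul_zero] at h1
        exact (mul_eq_zero.1 h1.symm).resolve_right hu
      simp [this]
    · have hb0 : b' d ≠ 0 := by
        intro h0
        have h1 := hb' d
        rw [h0, zero_mul] at h1
        exact (mul_ne_zero hu hv) h1
      have h1 := congrArg co (hb' d)
      rw [map_mul, map_mul, hcom] at h1
      have hU : co u ≠ 0 := fun h => hu (hcoi _ h)
      have hB : co (b' d) ≠ 0 := fun h => hb0 (hcoi _ h)
      have hM : monomial d (comp ℬ d v) ≠ 0 := by simpa using hv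
      have h2 := congrArg natDegree h1
      have h3 := congrArg natTrailingDegree h1
      rw [natDegree_mul hU hM, natDegree_mul hB hU, natDegree_monomial_eq _ hv] at h2
      rw [natTrailingDegree_mul hU hM, natTrailingDegree_mul hB hU,
        natTrailingDegree_monomial hv] at h3
      ext n
      rw [coeff_monomial]
      split_ifs with h
      · subst h; rw [hco]
      · rcases lt_or_gt_of_ne h with h | h
        · exact coeff_eq_zero_of_natDegree_lt (by omega)
        · exact coeff_eq_zero_of_lt_natTrailingDegree (by omega)
  have hoff : ∀ d n, d ≠ n → comp ℬ n (b' d) = 0 := by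
    intro d n hdn
    rw [← hco, hmon, coeff_monomial, if_neg hdn]
  have hval : comp ℬ d (b' d) = q • comp ℬ d v := by
    obtain ⟨s, hs⟩ := sum_comp ℬ v
    have h1 : (∑ d ∈ s, b' d) * u = (q • v) * u := by
      rw [smul_mul_assoc, ← h]
      conv_rhs => rw [hs]
      rw [Finset.mul_sum, Finset.sum_mul]
      exact Finset.sum_congr rfl fun d _ => (hb' d).symm
    have h2 := mul_right_cancel₀ hu h1
    have h3 := congrArg (comp ℬ d) h2
    rw [map_smul, map_sum] at h3
    by_cases hd : d ∈ s
    · rw [Finset.sum_eq_single d] at h3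
      · exact h3
      · intro b _ hbd; exact hoff b d hbd
      · intro hh; exact absurd hd hh
    · have hvd : comp ℬ d v = 0 := by
        rw [hs, map_sum]
        refine Finset.sum_eq_zero fun b hb => comp_ne ℬ (comp_mem ℬ b v) ?_
        rintro rfl; exact hd hb
      have : b' d = 0 := by
        have h1 := hb' d
        rw [hvd, mul_zero] at h1
        exact (mul_eq_zero.1 h1.symm).resolve_right hu
      rw [this, hvd]; simp
  have h1 := congrArg co (hb' d)
  rw [map_mul, map_mul, hcom, hmon, hval] at h1
  have h2 := congrArg (fun z => coeff z (e + d)) h1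
  simp only [coeff_mul_monomial, coeff_monomial_mul, hco] at h2
  rw [h2, smul_mul_assoc]

theorem nakayama (ε : B →ₐ[k] k) (hε : ∀ b, comp ℬ 0 b = algebraMap k B (ε b))
    {ι : Type*} (y : ι → B) (dd : ι → ℕ) (hy : ∀ i, y i ∈ ℬ (dd i))
    (h : LinearMap.ker ε.toLinearMap * LinearMap.ker ε.toLinearMap
      ⊔ Submodule.span k (Set.range y) = LinearMap.ker ε.toLinearMap) :
    Algebra.adjoin k (Set.range y) = ⊤ := by
  set m := LinearMap.ker ε.toLinearMap with hm
  obtain ⟨co, hco⟩ := exists_co ℬ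
  have hm0 : ∀ b ∈ m, comp ℬ 0 b = 0 := by
    intro b hb
    have : ε b = 0 := hb
    rw [hε, this, map_zero]
  have key : ∀ n, ∀ b : B, comp ℬ n b ∈ Algebra.adjoin k (Set.range y) := by
    intro n
    induction n using Nat.strong_induction_on with
    | _ n ih =>
      have hmm : ∀ b ∈ m, comp ℬ n b ∈ Algebra.adjoin k (Set.range y) := by
        intro b hb
        rw [← h] at hb
        obtain ⟨b1, hb1, b2, hb2, rfl⟩ := Submodule.mem_sup.1 hb
        rw [map_add]
        refine add_mem ?_ ?_
        · refine Submodule.mul_induction_on hb1 ?_ ?_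
          · intro f hf g hg
            rw [← hco, map_mul, coeff_mul]
            refine sum_mem ?_
            rintro ⟨i, j⟩ hij
            rw [Finset.HasAntidiagonal.mem_antidiagonal] at hij
            simp only [hco] at hij ⊢
            rcases Nat.eq_zero_or_pos i with hi | hi
            · rw [hi, hm0 f hf, zero_mul]; exact zero_mem _
            rcases Nat.eq_zero_or_pos j with hj | hj
            · rw [hj, hm0 g hg, mul_zero]; exact zero_mem _
            exact mul_mem (ih i (by omega) f) (ih j (by omega) g)
          · intro f g hf hg
            rw [map_add]; exact add_mem hf hg
        · clear hb
          induction hb2 using Submodule.span_induction with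
          | mem x hx =>
            obtain ⟨i, rfl⟩ := hx
            by_cases hd : dd i = n
            · subst hd; rw [comp_same ℬ (hy i)]; exact Algebra.subset_adjoin ⟨i, rfl⟩
            · rw [comp_ne ℬ (hy i) hd]; exact zero_mem _
          | zero => rw [map_zero]; exact zero_mem _
          | add x y _ _ hx hy =>
            rw [map_add]
            exact add_mem hx hy
          | smul c x _ hx =>
            rw [map_smul]
            exact Subalgebra.smul_mem _ hx c
      intro b
      have : b = algebraMap k B (ε b) + (b - algebraMap k B (ε b)) := by abel
      rw [this, map_add]
      refine add_mem ?_ (hmm _ (by simp [hm]))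
      have h0 : algebraMap k B (ε b) ∈ ℬ 0 := by rw [← hε]; exact comp_mem ℬ 0 b
      by_cases hn : 0 = n
      · subst hn; rw [comp_same ℬ h0]; exact Subalgebra.algebraMap_mem _ _
      · rw [comp_ne ℬ h0 hn]; exact zero_mem _
  rw [eq_top_iff]
  intro b _
  obtain ⟨s, hs⟩ := sum_comp ℬ b
  rw [hs]
  exact sum_mem fun d _ => key d b

theorem inter_pow (ε : B →ₐ[k] k) (hε : ∀ b, comp ℬ 0 b = algebraMap k B (ε b))
    (η : B[X] →ₐ[k] k) (hη : ∀ f, η f = ε (f.coeff 0)) (x : B[X])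
    (hx : ∀ n : ℕ, x ∈ (LinearMap.ker η.toLinearMap) ^ (n + 1)) : x = 0 := by
  obtain ⟨co, hco⟩ := exists_co ℬ
  have key : ∀ n, ∀ f ∈ (LinearMap.ker η.toLinearMap) ^ (n + 1), ∀ i j, i + j < n + 1 →
      comp ℬ j (f.coeff i) = 0 := by
    have h1 : ∀ f ∈ LinearMap.ker η.toLinearMap, comp ℬ 0 (f.coeff 0) = 0 := by
      intro f hf
      have : η f = 0 := hf
      rw [hε, ← hη, this, map_zero]
    intro n
    induction n with
    | zero =>
      intro f hf i j hij
      obtain ⟨rfl, rfl⟩ : i = 0 ∧ j = 0 := by omega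
      exact h1 f (by simpa using hf)
    | succ n ih =>
      intro f hf
      rw [pow_succ] at hf
      refine Submodule.mul_induction_on hf ?_ ?_
      · intro f hf g hg i j hij
        rw [coeff_mul, map_sum]
        refine Finset.sum_eq_zero ?_
        rintro ⟨a, b⟩ hab
        rw [Finset.HasAntidiagonal.mem_antidiagonal] at hab
        rw [← hco, map_mul, coeff_mul]
        refine Finset.sum_eq_zero ?_
        rintro ⟨c, d⟩ hcd
        rw [Finset.HasAntidiagonal.mem_antidiagonal] at hcd
        simp only [hco] at *
        by_cases hac : a + c < n + 1
        · rw [ih f hf a c hac, zero_mul]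
        · obtain ⟨rfl, rfl⟩ : b = 0 ∧ d = 0 := by omega
          rw [h1 g hg, mul_zero]
      · intro f g hf hg i j hij
        rw [coeff_add, map_add, hf i j hij, hg i j hij, add_zero]
  ext i
  rw [coeff_zero]
  exact eq_zero_of_comp ℬ fun j => key (i + j) x (hx _) i j (by omega)

end Graded

section Main
open Polynomial

theorem sup_mul_self {k R : Type*} [Field k] [Ring R] [Algebra k R] (ε : R →ₐ[k] k)
    (Z : Submodule k R) (h : LinearMap.ker ε.toLinearMap = Z * ⊤) :
    LinearMap.ker ε.toLinearMap * LinearMap.ker ε.toLinearMap ⊔ Z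
      = LinearMap.ker ε.toLinearMap := by
  set N := LinearMap.ker ε.toLinearMap with hN
  have hZN : Z ≤ N := by
    rw [h]
    intro z hz
    rw [← mul_one z]
    exact Submodule.mul_mem_mul hz trivial
  refine le_antisymm (sup_le ?_ hZN) ?_
  · rw [Submodule.mul_le]
    intro a ha b _
    have : ε a = 0 := ha
    simp [hN, this]
  · conv_lhs => rw [h]
    rw [Submodule.mul_le]
    intro a ha b _
    have : a * b = a * (b - algebraMap k R (ε b)) + (ε b) • a := by
      rw [mul_sub, ← Algebra.commutes, ← Algebra.smul_def]; abel
    rw [this]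
    refine Submodule.add_mem_sup (Submodule.mul_mem_mul (hZN ha) (by simp [hN])) ?_
    exact Submodule.smul_mem _ _ ha

theorem mat_lemma {k R : Type*} [Field k] [Ring R] [Algebra k R] {ι : Type*} [Fintype ι]
    [DecidableEq ι] (z : ι → R)
    (hz : Algebra.adjoin k (Set.range z) = ⊤) (η : R →ₐ[k] k) (h0 : ∀ i, η (z i) = 0)
    (P : k) (hP : P ≠ 1) (i0 j0 : ι) (hne : i0 ≠ j0) (ρ : R →ₐ[k] Matrix (Fin 3) (Fin 3) k)
    (h1 : ρ (z i0) = !![0, 1, 0; 0, 0, P; 0, 0, 0]) (h2 : ρ (z j0) = !![0, 1, 0; 0, 0, 1; 0, 0, 0])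
    (h3 : ∀ l, l ≠ i0 → l ≠ j0 → ρ (z l) = 0) (t : R) (ht : z j0 * t = t * z j0)
    (cf : ι → k) (hcf : t - ∑ l, cf l • z l ∈
      LinearMap.ker η.toLinearMap * LinearMap.ker η.toLinearMap) : cf i0 = 0 := by
  have key : ∀ x, ρ x 0 0 = η x ∧ ρ x 1 1 = η x ∧ ρ x 2 2 = η x ∧ ρ x 1 0 = 0 ∧ ρ x 2 0 = 0 ∧
      ρ x 2 1 = 0 := by
    intro x
    have hx : x ∈ Algebra.adjoin k (Set.range z) := by rw [hz]; trivial
    induction hx using Algebra.adjoin_induction with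
    | mem x hx =>
      obtain ⟨i, rfl⟩ := hx
      rw [h0]
      by_cases hi : i = i0
      · subst hi; rw [h1]; simp
      by_cases hj : i = j0
      · subst hj; rw [h2]; simp
      rw [h3 i hi hj]; simp
    | algebraMap r => simp [AlgHom.commutes, Matrix.algebraMap_matrix_apply]
    | add x y _ _ hx hy =>
      obtain ⟨a1, a2, a3, a4, a5, a6⟩ := hx
      obtain ⟨b1, b2, b3, b4, b5, b6⟩ := hy
      simp [a1, a2, a3, a4, a5, a6, b1, b2, b3, b4, b5, b6]
    | mul x y _ _ hx hy =>
      obtain ⟨a1, a2, a3, a4, a5, a6⟩ := hx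
      obtain ⟨b1, b2, b3, b4, b5, b6⟩ := hy
      simp [Matrix.mul_apply, Fin.sum_univ_three, a1, a2, a3, a4, a5, a6, b1, b2, b3, b4, b5, b6]
  have key2 : ∀ x ∈ LinearMap.ker η.toLinearMap * LinearMap.ker η.toLinearMap,
      ρ x 0 1 = 0 ∧ ρ x 1 2 = 0 := by
    intro x hx
    refine Submodule.mul_induction_on hx ?_ ?_
    · intro f hf g hg
      have hf' : η f = 0 := hf
      have hg' : η g = 0 := hg
      obtain ⟨a1, a2, a3, a4, a5, a6⟩ := key f
      obtain ⟨b1, b2, b3, b4, b5, b6⟩ := key g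
      simp [Matrix.mul_apply, Fin.sum_univ_three, a1, a2, a3, a4, a5, a6, b1, b2, b3, b4, b5, b6,
        hf', hg']
    · rintro f g ⟨hf, hf'⟩ ⟨hg, hg'⟩
      simp [hf, hf', hg, hg']
  obtain ⟨e1, e2⟩ := key2 _ hcf
  have hsum : ρ (∑ l, cf l • z l) = cf i0 • ρ (z i0) + cf j0 • ρ (z j0) := by
    rw [map_sum, Finset.sum_eq_add i0 j0 hne]
    · simp
    · intro l _ hl; rw [map_smul, h3 l hl.1 hl.2, smul_zero]
    · simp
    · simp
  rw [map_sub, hsum, h1, h2] at e1 e2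
  simp at e1 e2
  have e3 := congrArg (fun x => ρ x 0 2) ht
  simp only [map_mul, h2, Matrix.mul_apply, Fin.sum_univ_three] at e3
  simp at e3
  have : (P - 1) * cf i0 = 0 := by linear_combination e1 - e2 + e3
  exact (mul_eq_zero.1 this).resolve_left (sub_ne_zero.2 hP)

theorem adjoin_poly {k : Type*} [Field k] (p : Fin 3 → Fin 3 → k)
    (S : Subalgebra k (SkewPoly k 3 p)[X]) (h1 : ∀ i, C (gx p i) ∈ S) (h2 : X ∈ S) : S = ⊤ := by
  rw [eq_top_iff]
  intro f _
  have hC : ∀ a : SkewPoly k 3 p, C a ∈ S := by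
    intro a
    have ha : a ∈ Algebra.adjoin k (Set.range (gx p)) := by rw [adjoin_gx]; trivial
    induction ha using Algebra.adjoin_induction with
    | mem x hx => obtain ⟨i, rfl⟩ := hx; exact h1 i
    | algebraMap r =>
      have := S.algebraMap_mem r
      rwa [Polynomial.algebraMap_apply] at this
    | add x y _ _ hx hy => rw [C_add]; exact add_mem hx hy
    | mul x y _ _ hx hy => rw [C_mul]; exact mul_mem hx hy
  induction f using Polynomial.induction_on' with
  | add f g hf hg => exact add_mem (hf trivial) (hg trivial)
  | monomial n a =>
    rw [← C_mul_X_pow_eq_monomial]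
    exact mul_mem (hC a) (pow_mem h2 n)

theorem gx_rel' {k : Type*} [Field k] (p : Fin 3 → Fin 3 → k)
    (hp1 : ∀ i, p i i = 1) (hp2 : ∀ i j, p j i = (p i j)⁻¹) (hp : ∀ i j, p i j ≠ 0) (i j : Fin 3) :
    gx p j * gx p i = p i j • (gx p i * gx p j) := by
  rcases lt_trichotomy i j with h | h | h
  · exact gx_rel p h
  · subst h; rw [hp1, one_smul]
  · rw [gx_rel p h, smul_smul, hp2 j i, inv_mul_cancel₀ (hp j i), one_smul]

/-- extended parameters -/
def qq {k : Type*} [Field k] (p : Fin 3 → Fin 3 → k) : Option (Fin 3) → Option (Fin 3) → k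
  | some i, some j => p i j
  | _, _ => 1

end Main

section Final
open Polynomial

theorem shift_rel {k R : Type*} [Field k] [Ring R] [Algebra k R] (f g : R) (P a b : k)
    (h : g * f = P • (f * g)) (ha : a ≠ 0 → P = 1) (hb : b ≠ 0 → P = 1) :
    (g - algebraMap k R b) * (f - algebraMap k R a)
      = P • ((f - algebraMap k R a) * (g - algebraMap k R b)) := by
  by_cases hP : P = 1
  · subst hP
    rw [one_smul] at h ⊢
    simp only [sub_mul, mul_sub, h]
    rw [Algebra.commutes b f, ← Algebra.commutes a g, ← map_mul, ← map_mul, mul_comm a b]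
    abel
  · have ha0 : a = 0 := by by_contra hh; exact hP (ha hh)
    have hb0 : b = 0 := by by_contra hh; exact hP (hb hh)
    subst ha0; subst hb0
    simpa using h

theorem main (k : Type*) [Field k]
    (p : Fin 3 → Fin 3 → k)
    (hp1 : ∀ i, p i i = 1) (hp2 : ∀ i j, p j i = (p i j)⁻¹) (hp : ∀ i j, p i j ≠ 0)
    (B : Type*) [Ring B] [Algebra k B]
    (ℬ : ℕ → Submodule k B) [GradedAlgebra ℬ]
    (hconn : ∀ b ∈ ℬ 0, ∃ c : k, b = algebraMap k B c)
    (φ : Polynomial (SkewPoly k 3 p) ≃ₐ[k] Polynomial B) :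
    Nonempty (SkewPoly k 3 p ≃ₐ[k] B) := by
  classical
  have hsymm1 : ∀ i j, p i j = 1 → p j i = 1 := fun i j h => by rw [hp2, h, inv_one]
  haveI := noZeroDiv p hp
  haveI := nontriv p hp
  haveI : NoZeroDivisors B[X] := φ.symm.injective.noZeroDivisors φ.symm (map_zero _) (map_mul _)
  haveI : NoZeroDivisors B := C_injective.noZeroDivisors (C : B →+* B[X]) (map_zero _) (map_mul _)
  haveI : Nontrivial B[X] := φ.symm.surjective.nontrivial
  haveI : Nontrivial B := by
    by_contra hB
    rw [not_nontrivial_iff_subsingleton] at hB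
    exact not_subsingleton B[X] inferInstance
  obtain ⟨ε, hε⟩ := exists_aug ℬ hconn
  obtain ⟨co, hco⟩ := exists_co ℬ
  have hcoi : ∀ b, co b = 0 → b = 0 := fun b hb => eq_zero_of_comp ℬ fun n => by
    rw [← hco, hb, coeff_zero]
  let cc : B[X] →ₐ[k] B :=
    { (constantCoeff : B[X] →+* B) with
      commutes' := by intro r; simp [Polynomial.algebraMap_apply] }
  have hcc : ∀ f, cc f = f.coeff 0 := fun f => rfl
  have hccs : Function.Surjective cc := fun b => ⟨C b, by rw [hcc, coeff_C_zero]⟩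
  let η : B[X] →ₐ[k] k := ε.comp cc
  have hη : ∀ f, η f = ε (f.coeff 0) := fun f => rfl
  -- generators of the polynomial ring over `A`
  let x : Fin 3 → B[X] := fun i => φ (C (gx p i))
  have hxrel : ∀ i j, x j * x i = p i j • (x i * x j) := by
    intro i j
    have := congrArg (fun w => φ (C w)) (gx_rel' p hp1 hp2 hp i j)
    simpa [x, ← smul_C, C_mul] using this
  have hx0 : ∀ i, x i ≠ 0 := by
    intro i h
    have : C (gx p i) = 0 := φ.injective (by rw [map_zero]; exact h)
    exact gx_ne p hp i (C_eq_zero.1 this)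
  let a : Fin 3 → k := fun i => η (x i)
  let c : k := η (φ X)
  have HA : ∀ i j, a i ≠ 0 → p i j = 1 := by
    intro i j hai
    have h1 := trail _ _ _ (hxrel i j)
    have hb : (x j).trailingCoeff ≠ 0 := by
      rw [Ne, trailingCoeff_eq_zero]; exact hx0 j
    have h2 := congrArg co h1
    rw [map_mul, map_smul, map_mul] at h2
    have h3 := trail _ _ _ h2
    have hb' : (co (x j).trailingCoeff).trailingCoeff ≠ 0 := by
      rw [Ne, trailingCoeff_eq_zero]; exact fun h => hb (hcoi _ h)
    rw [hco, hε, ← hη, ← Algebra.commutes, ← Algebra.smul_def, smul_smul] at h3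
    have h4 := smul_left_injective k hb' h3
    have h5 : (p i j - 1) * a i = 0 := by
      simp only [a]; linear_combination -h4
    exact sub_eq_zero.1 ((mul_eq_zero.1 h5).resolve_right hai)
  have HA' : ∀ i j, a j ≠ 0 → p i j = 1 := fun i j h => hsymm1 _ _ (HA j i h)
  let z : Option (Fin 3) → B[X] := fun o =>
    o.elim (φ X - algebraMap k _ c) (fun i => x i - algebraMap k _ (a i))
  have hzs : ∀ i, z (some i) = x i - algebraMap k _ (a i) := fun i => rfl
  have hzn : z none = φ X - algebraMap k _ c := rfl
  have hXc : ∀ f, φ X * f = f * φ X := by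
    intro f
    obtain ⟨g, rfl⟩ := φ.surjective f
    rw [← map_mul, ← map_mul, X_mul]
  have hznc : ∀ f, z none * f = f * z none := by
    intro f
    rw [hzn, sub_mul, mul_sub, hXc, Algebra.commutes]
  have hzrel : ∀ o o', z o' * z o = qq p o o' • (z o * z o') := by
    intro o o'
    match o, o' with
    | none, o' => rw [hznc]; simp [qq]
    | some i, none => rw [hznc]; simp [qq]
    | some i, some j =>
      exact shift_rel _ _ _ _ _ (hxrel i j) (HA i j) (HA' i j)
  have hη0 : ∀ o, η (z o) = 0 := by
    intro o
    match o with
    | none => rw [hzn, map_sub, AlgHom.commutes]; exact sub_self _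
    | some i => rw [hzs, map_sub, AlgHom.commutes]; exact sub_self _
  have hzadj : Algebra.adjoin k (Set.range z) = ⊤ := by
    have h1 : (Algebra.adjoin k (Set.range z)).comap φ.toAlgHom = ⊤ := by
      apply adjoin_poly p
      · intro i
        have h2 : z (some i) + algebraMap k _ (a i) ∈ Algebra.adjoin k (Set.range z) :=
          add_mem (Algebra.subset_adjoin ⟨_, rfl⟩) (Subalgebra.algebraMap_mem _ _)
        rw [hzs, sub_add_cancel] at h2
        exact h2
      · have h2 : z none + algebraMap k _ c ∈ Algebra.adjoin k (Set.range z) :=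
          add_mem (Algebra.subset_adjoin ⟨_, rfl⟩) (Subalgebra.algebraMap_mem _ _)
        rw [hzn, sub_add_cancel] at h2
        exact h2
    rw [eq_top_iff]
    intro f _
    obtain ⟨g, rfl⟩ := φ.surjective f
    have : g ∈ (Algebra.adjoin k (Set.range z)).comap φ.toAlgHom := by rw [h1]; trivial
    exact this
  have hN := ker_eq_mul_top z hzadj η hη0
  have hN2 := sup_mul_self η _ hN
  -- images in `B`
  let Z : Option (Fin 3) → B := fun o => cc (z o)
  have hZ0 : ∀ o, ε (Z o) = 0 := hη0
  have hZrel : ∀ o o', Z o' * Z o = qq p o o' • (Z o * Z o') := by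
    intro o o'
    simp only [Z, ← map_mul, ← map_smul, hzrel o o']
  have hZadj : Algebra.adjoin k (Set.range Z) = ⊤ := by
    have h2 := congrArg (Subalgebra.map cc) hzadj
    rw [AlgHom.map_adjoin, Algebra.map_top, ← Set.range_comp, (AlgHom.range_eq_top _).2 hccs] at h2
    exact h2
  have hm := ker_eq_mul_top Z hZadj ε hZ0
  have hm2 := sup_mul_self ε _ hm
  have hnormal : ∀ o b, ∃ b', Z o * b = b' * Z o := by
    intro o b
    have hb : b ∈ Algebra.adjoin k (Set.range Z) := by rw [hZadj]; trivial
    induction hb using Algebra.adjoin_induction with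
    | mem y hy =>
      obtain ⟨o', rfl⟩ := hy
      exact ⟨qq p o' o • Z o', by rw [hZrel o' o, smul_mul_assoc]⟩
    | algebraMap r => exact ⟨algebraMap k B r, (Algebra.commutes _ _).symm⟩
    | add u v _ _ hu hv =>
      obtain ⟨u', hu⟩ := hu
      obtain ⟨v', hv⟩ := hv
      exact ⟨u' + v', by rw [mul_add, add_mul, hu, hv]⟩
    | mul u v _ _ hu hv =>
      obtain ⟨u', hu⟩ := hu
      obtain ⟨v', hv⟩ := hv
      exact ⟨u' * v', by rw [← mul_assoc, hu, mul_assoc, hv, mul_assoc]⟩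
  -- linear part of the variable of `B[t]`
  obtain ⟨cf, hcf⟩ : ∃ cf : Option (Fin 3) → k, X - ∑ l, cf l • z l ∈
      LinearMap.ker η.toLinearMap * LinearMap.ker η.toLinearMap := by
    have hX : (X : B[X]) ∈ LinearMap.ker η.toLinearMap := by simp [hη]
    rw [← hN2] at hX
    obtain ⟨n, hn, w, hw, hnw⟩ := Submodule.mem_sup.1 hX
    obtain ⟨cf, rfl⟩ := (Submodule.mem_span_range_iff_exists_fun k).1 hw
    exact ⟨cf, by rw [← hnw]; simpa using hn⟩
  have hcf0 : ∀ i j, p i j ≠ 1 → cf (some i) = 0 := by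
    intro i j hij
    have hne : i ≠ j := by rintro rfl; exact hij (hp1 _)
    have hai : a i = 0 := by by_contra h; exact hij (HA i j h)
    have haj : a j = 0 := by by_contra h; exact hij (HA' i j h)
    let M1 : Matrix (Fin 3) (Fin 3) k := !![0, 1, 0; 0, 0, p i j; 0, 0, 0]
    let M2 : Matrix (Fin 3) (Fin 3) k := !![0, 1, 0; 0, 0, 1; 0, 0, 0]
    let mm : Fin 3 → Matrix (Fin 3) (Fin 3) k := fun l =>
      if l = i then M1 else if l = j then M2 else algebraMap k _ (a l)
    have hM21 : M2 * M1 = p i j • (M1 * M2) := by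
      ext r s
      fin_cases r <;> fin_cases s <;> simp [M1, M2, Matrix.mul_apply, Fin.sum_univ_three]
    have hsc : ∀ (P b : k) (M : Matrix (Fin 3) (Fin 3) k), (b ≠ 0 → P = 1) →
        M * algebraMap k _ b = P • (algebraMap k _ b * M) := by
      intro P b M hb
      by_cases h : b = 0
      · subst h; simp
      · rw [hb h, one_smul, Algebra.commutes]
    have hsc' : ∀ (P b : k) (M : Matrix (Fin 3) (Fin 3) k), (b ≠ 0 → P = 1) →
        algebraMap k _ b * M = P • (M * algebraMap k _ b) := by
      intro P b M hb
      by_cases h : b = 0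
      · subst h; simp
      · rw [hb h, one_smul, Algebra.commutes]
    have hmm : ∀ l l', mm l' * mm l = p l l' • (mm l * mm l') := by
      intro l l'
      by_cases hl : l = i ∨ l = j
      · by_cases hl' : l' = i ∨ l' = j
        · rcases hl with rfl | rfl <;> rcases hl' with rfl | rfl
          · rw [hp1, one_smul]
          · simpa [mm, hne.symm] using hM21
          · simp only [mm, hne.symm, if_true, if_false]
            rw [hM21, smul_smul, hp2 l' l, inv_mul_cancel₀ (hp _ _), one_smul]
          · rw [hp1, one_smul]
        · rw [not_or] at hl'
          have : mm l' = algebraMap k _ (a l') := by simp [mm, hl'.1, hl'.2]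
          rw [this]
          exact hsc' _ _ _ (HA' l l')
      · rw [not_or] at hl
        have : mm l = algebraMap k _ (a l) := by simp [mm, hl.1, hl.2]
        rw [this]
        exact hsc _ _ _ (HA l l')
    let ρ0 : (SkewPoly k 3 p)[X] →ₐ[k] Matrix (Fin 3) (Fin 3) k :=
      eval₂AlgHom (lift p mm fun l l' _ => hmm l l') (algebraMap k _ c)
        (fun b => (Algebra.commutes c _).symm)
    have hρC : ∀ b, ρ0 (C b) = lift p mm (fun l l' _ => hmm l l') b := fun b => eval₂_C _ _
    have hρX : ρ0 X = algebraMap k _ c := eval₂_X _ _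
    have hρs : ∀ l, (ρ0.comp φ.symm.toAlgHom) (z (some l)) = mm l - algebraMap k _ (a l) := by
      intro l
      rw [hzs, map_sub, AlgHom.commutes]
      congr 1
      change ρ0 (φ.symm (φ (C (gx p l)))) = _
      rw [AlgEquiv.symm_apply_apply, hρC, lift_gx]
    have hρn : (ρ0.comp φ.symm.toAlgHom) (z none) = 0 := by
      rw [hzn, map_sub, AlgHom.commutes, sub_eq_zero]
      change ρ0 (φ.symm (φ X)) = _
      rw [AlgEquiv.symm_apply_apply, hρX]
    refine mat_lemma z hzadj η hη0 (p i j) hij (some i) (some j) (by simpa using hne)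
      (ρ0.comp φ.symm.toAlgHom) ?_ ?_ ?_ X (X_mul).symm cf hcf
    · rw [hρs, hai, map_zero, sub_zero]; simp [mm, M1]
    · rw [hρs, haj, map_zero, sub_zero]; simp [mm, M2, hne.symm]
    · intro l h1 h2
      match l with
      | none => exact hρn
      | some l =>
        have h1' : l ≠ i := fun h => h1 (by rw [h])
        have h2' : l ≠ j := fun h => h2 (by rw [h])
        rw [hρs]; simp [mm, h1', h2']
  obtain ⟨o, ho⟩ : ∃ o, cf o ≠ 0 := by
    by_contra hcon
    push Not at hcon
    simp only [hcon, zero_smul, Finset.sum_const_zero, sub_zero] at hcf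
    have h1 : ∀ f ∈ LinearMap.ker η.toLinearMap * LinearMap.ker η.toLinearMap,
        ε (f.coeff 1) = 0 := by
      intro f hf
      refine Submodule.mul_induction_on hf ?_ ?_
      · intro f hf g hg
        have hf' : ε (f.coeff 0) = 0 := hf
        have hg' : ε (g.coeff 0) = 0 := hg
        simp [coeff_mul, Finset.Nat.antidiagonal_succ, hf', hg']
      · intro f g hf hg
        rw [coeff_add, map_add, hf, hg, add_zero]
    have := h1 _ hcf
    rw [coeff_X_one, map_one] at this
    exact one_ne_zero this
  obtain ⟨e, he1, he2⟩ : ∃ e : Fin 3 → Option (Fin 3), (∀ o', o' ≠ o → ∃ i, e i = o') ∧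
      ∀ i j, qq p (e i) (e j) = p i j := by
    match o, ho with
    | none, ho =>
      refine ⟨some, ?_, fun i j => rfl⟩
      intro o' ho'
      exact ⟨_, Option.some_get (Option.isSome_iff_ne_none.2 ho')⟩
    | some i0, ho =>
      have hc1 : ∀ j, p i0 j = 1 := by
        intro j
        by_contra h
        exact ho (hcf0 i0 j h)
      have hc2 : ∀ j, p j i0 = 1 := fun j => hsymm1 _ _ (hc1 j)
      refine ⟨fun i => if i = i0 then none else some i, ?_, ?_⟩
      · intro o' ho'
        match o' with
        | none => exact ⟨i0, by simp⟩
        | some i => exact ⟨i, by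
            have : i ≠ i0 := fun h => ho' (by rw [h])
            simp [this]⟩
      · intro i j
        by_cases hi : i = i0
        · subst hi; simp [qq, hc1]
        · by_cases hj : j = i0
          · subst hj; simp [qq, hc2]
          · simp [qq, hi, hj]
  let m := LinearMap.ker ε.toLinearMap
  have hspan : m * m ⊔ Submodule.span k (Set.range fun i => Z (e i)) = m := by
    have hle : m * m ⊔ Submodule.span k (Set.range fun i => Z (e i)) ≤ m := by
      conv_rhs => rw [show m = _ from hm2.symm]
      refine sup_le_sup_left (Submodule.span_mono ?_) _
      rintro _ ⟨i, rfl⟩; exact ⟨_, rfl⟩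
    refine le_antisymm hle ?_
    conv_lhs => rw [show m = _ from hm2.symm]
    refine sup_le le_sup_left ?_
    rw [Submodule.span_le]
    rintro _ ⟨o', rfl⟩
    have hoth : ∀ o', o' ≠ o →
        Z o' ∈ m * m ⊔ Submodule.span k (Set.range fun i => Z (e i)) := by
      intro o' h
      obtain ⟨i, rfl⟩ := he1 o' h
      exact Submodule.mem_sup_right (Submodule.subset_span ⟨i, rfl⟩)
    by_cases h : o' = o
    · subst h
      have h1 : cc (X - ∑ l, cf l • z l) ∈ m * m := by
        have : Submodule.map cc.toLinearMap
            (LinearMap.ker η.toLinearMap * LinearMap.ker η.toLinearMap) ≤ m * m := by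
          rw [Submodule.map_mul]
          refine mul_le_mul' ?_ ?_ <;>
          · rintro _ ⟨f, hf, rfl⟩
            exact hf
        exact this ⟨_, hcf, rfl⟩
      rw [map_sub, map_sum, hcc X, coeff_X_zero, zero_sub, ← Finset.add_sum_erase _ _
        (Finset.mem_univ o')] at h1
      have h2 : cf o' • Z o' ∈ m * m ⊔ Submodule.span k (Set.range fun i => Z (e i)) := by
        have h3 : cf o' • Z o' = -(-(cc (cf o' • z o')
            + ∑ l ∈ Finset.univ.erase o', cc (cf l • z l)))
            - ∑ l ∈ Finset.univ.erase o', cf l • Z l := by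
          simp [Z]
        rw [h3]
        refine sub_mem (neg_mem (Submodule.mem_sup_left h1)) (sum_mem fun l hl => ?_)
        exact Submodule.smul_mem _ _ (hoth l (Finset.ne_of_mem_erase hl))
      exact (Submodule.smul_mem_iff _ ho).1 h2
    · exact hoth o' h
  have hcompm : ∀ d b, ε b = 0 → ε (comp ℬ d b) = 0 := by
    intro d b hb
    apply (algebraMap k B).injective
    rw [← hε, map_zero]
    by_cases hd : d = 0
    · subst hd; rw [comp_same ℬ (comp_mem ℬ 0 b), hε, hb, map_zero]
    · exact comp_ne ℬ (comp_mem ℬ d b) hd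
  choose s hs using fun i => sum_comp ℬ (Z (e i))
  obtain ⟨d, hd⟩ := exchange (m * m) m (fun i => Z (e i)) (fun i d => comp ℬ d (Z (e i))) s hs
    (fun i d => hcompm d _ (hZ0 _)) hspan
  let y : Fin 3 → B := fun i => comp ℬ (d i) (Z (e i))
  have hyadj : Algebra.adjoin k (Set.range y) = ⊤ :=
    nakayama ℬ ε hε y d (fun i => comp_mem ℬ _ _) hd
  have hyrel : ∀ i j, i < j → y j * y i = p i j • (y i * y j) := by
    intro i j _
    refine skew_comp ℬ (hnormal _) (p i j) ?_ _ _
    rw [hZrel (e i) (e j), he2]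
  let F := lift p y hyrel
  have hFs : Function.Surjective F := by
    rw [← AlgHom.range_eq_top, eq_top_iff, ← hyadj]
    refine Algebra.adjoin_le ?_
    rintro _ ⟨i, rfl⟩
    exact ⟨gx p i, lift_gx _ _ _ _⟩
  let G : (SkewPoly k 3 p)[X] →ₐ[k] B[X] := mapAlgHom F
  have hGC : ∀ b, G (C b) = C (F b) := fun b => map_C _
  have hGX : G X = X := map_X _
  have hGs : Function.Surjective G := map_surjective F.toRingHom hFs
  have hΘrel : ∀ i j, i < j → (C (gx p j) - algebraMap k (SkewPoly k 3 p)[X] (-a j))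
      * (C (gx p i) - algebraMap k (SkewPoly k 3 p)[X] (-a i))
      = p i j • ((C (gx p i) - algebraMap k (SkewPoly k 3 p)[X] (-a i))
        * (C (gx p j) - algebraMap k (SkewPoly k 3 p)[X] (-a j))) := by
    intro i j _
    refine shift_rel (k := k) (R := (SkewPoly k 3 p)[X]) (C (gx p i)) (C (gx p j)) (p i j) (-a i)
      (-a j) ?_ (fun h => HA i j (by simpa using h))
      (fun h => HA' i j (by simpa using h))
    rw [← C_mul, gx_rel' p hp1 hp2 hp i j, ← C_mul, smul_C]
  let Θ : (SkewPoly k 3 p)[X] →ₐ[k] (SkewPoly k 3 p)[X] :=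
    eval₂AlgHom (lift p _ hΘrel) (X + algebraMap k _ c)
      (fun b => Commute.add_right (X_mul).symm (Algebra.commutes c _).symm)
  have hΘC : ∀ i, Θ (C (gx p i)) = C (gx p i) + algebraMap k _ (a i) := by
    intro i
    refine (eval₂_C _ _).trans ?_
    refine (lift_gx _ _ _ _).trans ?_
    rw [map_neg, sub_neg_eq_add]
  have hΘX : Θ X = X + algebraMap k _ c := eval₂_X _ _
  have hΘs : Function.Surjective Θ := by
    rw [← AlgHom.range_eq_top]
    apply adjoin_poly
    · intro i
      refine ⟨C (gx p i) + algebraMap k _ (-a i), ?_⟩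
      change Θ _ = _
      rw [map_add, AlgHom.commutes, hΘC, add_assoc, ← map_add, add_neg_cancel, map_zero, add_zero]
    · refine ⟨X + algebraMap k _ (-c), ?_⟩
      change Θ _ = _
      rw [map_add, AlgHom.commutes, hΘX, add_assoc, ← map_add, add_neg_cancel, map_zero, add_zero]
  let ψ : B[X] →ₐ[k] (SkewPoly k 3 p)[X] := Θ.comp φ.symm.toAlgHom
  have hψs : Function.Surjective ψ := hΘs.comp φ.symm.surjective
  let π : B[X] →ₐ[k] B[X] := G.comp ψ
  have hπs : Function.Surjective π := hGs.comp hψs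
  have hπη : η.comp π = η := by
    apply AlgHom.ext_of_adjoin_eq_top hzadj
    rintro _ ⟨o, rfl⟩
    rw [hη0]
    match o with
    | none =>
      have : π (z none) = X := by
        rw [hzn, map_sub, AlgHom.commutes]
        change G (Θ (φ.symm (φ X))) - _ = _
        rw [AlgEquiv.symm_apply_apply, hΘX, map_add, AlgHom.commutes, hGX, add_sub_cancel_right]
      rw [AlgHom.comp_apply, this, hη, coeff_X_zero, map_zero]
    | some i =>
      have : π (z (some i)) = C (y i) := by
        rw [hzs, map_sub, AlgHom.commutes]
        change G (Θ (φ.symm (φ (C (gx p i))))) - _ = _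
        rw [AlgEquiv.symm_apply_apply, hΘC, map_add, AlgHom.commutes, hGC, add_sub_cancel_right]
        congr 1
        exact lift_gx _ _ _ _
      rw [AlgHom.comp_apply, this, hη, coeff_C_zero]
      exact hcompm _ _ (hZ0 _)
  have hπi : Function.Injective π :=
    hopf η _ (Submodule.fg_span (Set.finite_range z)) hN (inter_pow ℬ ε hε η hη) π hπs
      (fun f => congrArg (fun w => w f) hπη)
  have hGi : Function.Injective G := by
    intro f g hfg
    obtain ⟨f, rfl⟩ := hψs f
    obtain ⟨g, rfl⟩ := hψs g
    rw [hπi hfg]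
  have hFi : Function.Injective F := by
    intro f g hfg
    apply C_injective
    apply hGi
    rw [hGC, hGC, hfg]
  exact ⟨AlgEquiv.ofBijective F ⟨hFi, hFs⟩⟩

end Final

end Cancel

/-- Suppose `k` is algebraically closed of characteristic 0. Let
`A = k_p[x_1,x_2,x_3]` be a PI skew polynomial ring in three variables (all `p_{ij}`
roots of unity). Then `A` is cancellative in the class of connected graded `k`-algebras:
for every connected `ℕ`-graded `k`-algebra `B`, if `A[t] ≅ B[t]` as `k`-algebras,
then `A ≅ B` as `k`-algebras. -/
theorem stmt18 (k : Type*) [Field k] [CharZero k] [IsAlgClosed k]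
    (p : Fin 3 → Fin 3 → k)
    (hp1 : ∀ i, p i i = 1) (hp2 : ∀ i j, p j i = (p i j)⁻¹)
    (hroot : ∀ i j, ∃ m : ℕ, 0 < m ∧ p i j ^ m = 1)
    (B : Type*) [Ring B] [Algebra k B]
    (ℬ : ℕ → Submodule k B) [GradedAlgebra ℬ]
    (hconn : ∀ b ∈ ℬ 0, ∃ c : k, b = algebraMap k B c)
    (hfd : ∀ i, Module.Finite k ↥(ℬ i))
    (hiso : Nonempty (Polynomial (SkewPoly k 3 p) ≃ₐ[k] Polynomial B)) :
    Nonempty (SkewPoly k 3 p ≃ₐ[k] B) := by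
  obtain ⟨φ⟩ := hiso
  have hp : ∀ i j, p i j ≠ 0 := by
    intro i j h
    obtain ⟨m, hm, h1⟩ := hroot i j
    rw [h, zero_pow hm.ne'] at h1
    exact zero_ne_one h1
  exact Cancel.main k p hp1 hp2 hp B ℬ hconn φ
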